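/- For every positive integer m and every Dyck word w of length 2m, g(m,w,M_132) ≤ g(m,w,M_123); i.e., the number of matchings on [2m] with base w avoiding M_132 is at most the number of matchings on [2m] with base w avoiding M_123. -/

import Mathlib

/-- `G` is a matching on the vertex set `[n] = {1,…,n}`:
every edge has both endpoints in `[n]`, and every vertex of `[n]` has exactly one neighbour. -/
def IsMatchingOn (n : ℕ) (G : SimpleGraph ℕ) : Prop :=
  (∀ u v : ℕ, G.Adj u v → 1 ≤ u ∧ u ≤ n ∧ 1 ≤ v ∧ v ≤ n) ∧
  (∀ v : ℕ, 1 ≤ v → v ≤ n → ∃! u : ℕ, G.Adj v u)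

/-- `G` contains `H`: there is a monotone edge-preserving injection from the
vertices of `H` to those of `G`. -/
def ContainsPat (G H : SimpleGraph ℕ) : Prop :=
  ∃ f : ℕ → ℕ, StrictMono f ∧ ∀ u v : ℕ, H.Adj u v → G.Adj (f u) (f v)

/-- `w` (on positions `1,…,n`) is a Dyck word of length `n`: exactly half of its letters
are `1` (`true`), and every prefix has at most half of its letters equal to `1`. -/
def IsDyckWord (n : ℕ) (w : ℕ → Bool) : Prop :=
  2 * ((Finset.Icc 1 n).filter fun i => w i = true).card = n ∧
  ∀ k : ℕ, k ≤ n → 2 * ((Finset.Icc 1 k).filter fun i => w i = true).card ≤ k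

/-- The matching `G` on `[n]` has base `w`: `w i = 1` iff `i` is an r-vertex. -/
def HasBase (n : ℕ) (G : SimpleGraph ℕ) (w : ℕ → Bool) : Prop :=
  ∀ i : ℕ, 1 ≤ i → i ≤ n → (w i = true ↔ ∃ j : ℕ, j < i ∧ G.Adj i j)

/-- The matching `M_123` on `[6]`, with edges `{1,4},{2,5},{3,6}`. -/
def M123 : SimpleGraph ℕ := SimpleGraph.fromRel fun u v => (u, v) ∈ [(1,4),(2,5),(3,6)]
/-- The matching `M_132` on `[6]`, with edges `{1,4},{2,6},{3,5}`. -/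
def M132 : SimpleGraph ℕ := SimpleGraph.fromRel fun u v => (u, v) ∈ [(1,4),(2,6),(3,5)]
/-- The matching `M_213` on `[6]`, with edges `{1,5},{2,4},{3,6}`. -/
def M213 : SimpleGraph ℕ := SimpleGraph.fromRel fun u v => (u, v) ∈ [(1,5),(2,4),(3,6)]
/-- The matching `M_231` on `[6]`, with edges `{1,5},{2,6},{3,4}`. -/
def M231 : SimpleGraph ℕ := SimpleGraph.fromRel fun u v => (u, v) ∈ [(1,5),(2,6),(3,4)]
/-- The matching `M_321` on `[6]`, with edges `{1,6},{2,5},{3,4}`. -/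
def M321 : SimpleGraph ℕ := SimpleGraph.fromRel fun u v => (u, v) ∈ [(1,6),(2,5),(3,4)]

/-- The matching `C_k` on `[2k]`, with edges `{2i-1, 2i+2}` for `1 ≤ i < k`
together with the edge `{2, 2k-1}`. -/
def Ck (k : ℕ) : SimpleGraph ℕ :=
  SimpleGraph.fromRel fun u v =>
    (∃ i : ℕ, 1 ≤ i ∧ i < k ∧ u = 2*i - 1 ∧ v = 2*i + 2) ∨ (u = 2 ∧ v = 2*k - 1)

/-- `G[k]`: the subgraph of `G` induced by the vertex set `[k]`. -/
def restrictG (G : SimpleGraph ℕ) (k : ℕ) : SimpleGraph ℕ :=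
  SimpleGraph.fromRel fun u v => G.Adj u v ∧ u ≤ k ∧ v ≤ k

/-- A stub of a graph on `[k]`: an isolated vertex. -/
def IsStubOn (k : ℕ) (G : SimpleGraph ℕ) (v : ℕ) : Prop :=
  1 ≤ v ∧ v ≤ k ∧ ∀ u : ℕ, ¬ G.Adj v u

/-- The relation `∼`: `u ∼ v` iff `u = v` or some edge `{x,y}` satisfies
`x < u < y` and `x < v < y`. -/
def SimRel (G : SimpleGraph ℕ) (u v : ℕ) : Prop :=
  u = v ∨ ∃ x y : ℕ, G.Adj x y ∧ x < u ∧ u < y ∧ x < v ∧ v < y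

/-- The edges `{a,b}` and `{c,d}` (with `a < b`, `c < d`) cross. -/
def EdgesCross (a b c d : ℕ) : Prop :=
  (a < c ∧ c < b ∧ b < d) ∨ (c < a ∧ a < d ∧ d < b)

/-- The relation `≈`: `u ≈ v` iff `u = v` or there is a sequence of edges
`e_1,…,e_p` (`p ≥ 1`), consecutive ones crossing, with `e_1` spanning `u` and `e_p` spanning `v`. -/
def ApproxRel (G : SimpleGraph ℕ) (u v : ℕ) : Prop :=
  u = v ∨ ∃ p : ℕ, 1 ≤ p ∧ ∃ x y : ℕ → ℕ,
    (∀ i : ℕ, i < p → x i < y i ∧ G.Adj (x i) (y i)) ∧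
    (∀ i : ℕ, i + 1 < p → EdgesCross (x i) (y i) (x (i+1)) (y (i+1))) ∧
    x 0 < u ∧ u < y 0 ∧ x (p-1) < v ∧ v < y (p-1)

/-- The map sending `1, …, 6` to `p, q, x, r, s, u`, extended to `ℕ` by translation above `6`. -/
def sixPoints (p q x r s u : ℕ) : ℕ → ℕ
  | 0 => 0
  | 1 => p
  | 2 => q
  | 3 => x
  | 4 => r
  | 5 => s
  | j + 6 => u + j

theorem strictMono_sixPoints {p q x r s u : ℕ} (hp : 0 < p) (hpq : p < q)
    (hqx : q < x) (hxr : x < r) (hrs : r < s) (hsu : s < u) :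
    StrictMono (sixPoints p q x r s u) := by
  refine strictMono_nat_of_lt_succ fun i => ?_
  rcases i with _ | _ | _ | _ | _ | _ | i <;> simp only [sixPoints] <;> omega

theorem containsPat_M132 {G : SimpleGraph ℕ} {p q x r s u : ℕ} (hp : 0 < p) (hpq : p < q)
    (hqx : q < x) (hxr : x < r) (hrs : r < s) (hsu : s < u)
    (h₁ : G.Adj p r) (h₂ : G.Adj q u) (h₃ : G.Adj x s) : ContainsPat G M132 := by
  refine ⟨sixPoints p q x r s u, strictMono_sixPoints hp hpq hqx hxr hrs hsu, ?_⟩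
  intro a b hab
  simp only [M132, SimpleGraph.fromRel_adj, List.mem_cons, Prod.mk.injEq, List.not_mem_nil,
    or_false] at hab
  rcases hab.2 with (⟨rfl, rfl⟩ | ⟨rfl, rfl⟩ | ⟨rfl, rfl⟩) | (⟨rfl, rfl⟩ | ⟨rfl, rfl⟩ | ⟨rfl, rfl⟩)
  exacts [h₁, h₂, h₃, h₁.symm, h₂.symm, h₃.symm]

theorem containsPat_M123 {G : SimpleGraph ℕ} {p q x r s u : ℕ} (hp : 0 < p) (hpq : p < q)
    (hqx : q < x) (hxr : x < r) (hrs : r < s) (hsu : s < u)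
    (h₁ : G.Adj p r) (h₂ : G.Adj q s) (h₃ : G.Adj x u) : ContainsPat G M123 := by
  refine ⟨sixPoints p q x r s u, strictMono_sixPoints hp hpq hqx hxr hrs hsu, ?_⟩
  intro a b hab
  simp only [M123, SimpleGraph.fromRel_adj, List.mem_cons, Prod.mk.injEq, List.not_mem_nil,
    or_false] at hab
  rcases hab.2 with (⟨rfl, rfl⟩ | ⟨rfl, rfl⟩ | ⟨rfl, rfl⟩) | (⟨rfl, rfl⟩ | ⟨rfl, rfl⟩ | ⟨rfl, rfl⟩)
  exacts [h₁, h₂, h₃, h₁.symm, h₂.symm, h₃.symm]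

theorem ContainsPat.exists_crossing {G : SimpleGraph ℕ} (h : ContainsPat G M123) :
    ∃ p q x r s u : ℕ, p < q ∧ q < x ∧ x < r ∧ r < s ∧ s < u ∧
      G.Adj p r ∧ G.Adj q s ∧ G.Adj x u := by
  obtain ⟨f, hf, h⟩ := h
  exact ⟨f 1, f 2, f 3, f 4, f 5, f 6, hf (by omega), hf (by omega), hf (by omega),
    hf (by omega), hf (by omega), h 1 4 (by simp [M123]), h 2 5 (by simp [M123]),
    h 3 6 (by simp [M123])⟩

/-- The order embedding of `ℕ` into itself that omits the value `a`. -/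
def skip (a i : ℕ) : ℕ := if i < a then i else i + 1

/-- `G` is a partial matching on `[t]` compatible with the word `w`,
whose stubs are `σ 0 < ⋯ < σ (k - 1)`. -/
structure IsPartialMatching (w : ℕ → Bool) (t k : ℕ) (G : SimpleGraph ℕ) (σ : ℕ → ℕ) : Prop where
  supp : ∀ ⦃u v⦄, G.Adj u v → 1 ≤ u ∧ u ≤ t
  uniq : ∀ ⦃v u u'⦄, G.Adj v u → G.Adj v u' → u = u'
  base : HasBase t G w
  mono : ∀ ⦃i j⦄, i < j → j < k → σ i < σ j
  stub : ∀ v, IsStubOn t G v ↔ ∃ i < k, σ i = v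

/-- Some edge of `G` spans both `u` and `v`, where `u < v`. -/
def Linked (G : SimpleGraph ℕ) (u v : ℕ) : Prop :=
  ∃ x y, G.Adj x y ∧ x < u ∧ v < y

/-- The matchings on `[n]` with base `w` that avoid `H` and agree with `G` on `[t]`. -/
def extensions (n : ℕ) (w : ℕ → Bool) (H : SimpleGraph ℕ) (t : ℕ) (G : SimpleGraph ℕ) :
    Set (SimpleGraph ℕ) :=
  {K | IsMatchingOn n K ∧ HasBase n K w ∧ ¬ ContainsPat K H ∧
    ∀ u v, u ≤ t → v ≤ t → (K.Adj u v ↔ G.Adj u v)}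

/-- `G` has no three pairwise crossing edges, and no two crossing edges that both span the same
stub from its right: such a stub could only be closed by creating three crossing edges. -/
def Extendable (t : ℕ) (G : SimpleGraph ℕ) : Prop :=
  ¬ ContainsPat G M123 ∧
    ∀ p q x r s, p < q → q < x → x < r → r < s → G.Adj p r → G.Adj q s → ¬ IsStubOn t G x

theorem sup_edge_adj {G : SimpleGraph ℕ} {x y : ℕ} (h : x < y) (u v : ℕ) :
    (G ⊔ SimpleGraph.edge x y).Adj u v ↔
      G.Adj u v ∨ (u = x ∧ v = y) ∨ (u = y ∧ v = x) := by
  simp only [SimpleGraph.sup_adj, SimpleGraph.edge_adj]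
  constructor
  · rintro (h | ⟨h, -⟩) <;> tauto
  · rintro (h | ⟨rfl, rfl⟩ | ⟨rfl, rfl⟩)
    · exact Or.inl h
    · exact Or.inr ⟨by simp, h.ne⟩
    · exact Or.inr ⟨by simp, h.ne'⟩

theorem finite_setOf_isMatchingOn (n : ℕ) : {K : SimpleGraph ℕ | IsMatchingOn n K}.Finite := by
  have hfin := (Finset.range (n + 1) ×ˢ Finset.range (n + 1)).powerset.finite_toSet
  classical
  refine Set.Finite.of_finite_image (f := fun K : SimpleGraph ℕ =>
    (Finset.range (n + 1) ×ˢ Finset.range (n + 1)).filter fun e => K.Adj e.1 e.2)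
    (hfin.subset ?_) ?_
  · rintro _ ⟨K, -, rfl⟩
    exact Finset.mem_coe.2 (Finset.mem_powerset.2 (Finset.filter_subset _ _))
  · intro K hK K' hK' h
    ext u v
    have h' := Finset.ext_iff.1 h (u, v)
    simp only [Finset.mem_filter, Finset.mem_product, Finset.mem_range] at h'
    constructor
    · intro huv
      have := hK.1 u v huv
      exact (h'.1 ⟨by omega, huv⟩).2
    · intro huv
      have := hK'.1 u v huv
      exact (h'.2 ⟨by omega, huv⟩).2

theorem finite_extensions (n : ℕ) (w : ℕ → Bool) (H : SimpleGraph ℕ) (t : ℕ) (G : SimpleGraph ℕ) :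
    (extensions n w H t G).Finite :=
  (finite_setOf_isMatchingOn n).subset fun _ hK => hK.1

namespace IsPartialMatching

variable {w : ℕ → Bool} {t k : ℕ} {G : SimpleGraph ℕ} {σ : ℕ → ℕ}

theorem isStubOn (h : IsPartialMatching w t k G σ) {i : ℕ} (hi : i < k) : IsStubOn t G (σ i) :=
  (h.stub _).2 ⟨i, hi, rfl⟩

theorem lt_of_lt (h : IsPartialMatching w t k G σ) {i j : ℕ} (hi : i < k) (hij : σ i < σ j) :
    i < j := by
  by_contra hji
  rcases (not_lt.1 hji).lt_or_eq with hlt | rfl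
  · exact absurd (h.mono hlt hi) (by omega)
  · exact lt_irrefl _ hij

theorem le_of_le (h : IsPartialMatching w t k G σ) {i j : ℕ} (hij : i ≤ j) (hj : j < k) :
    σ i ≤ σ j := by
  rcases hij.lt_or_eq with hlt | rfl
  · exact (h.mono hlt hj).le
  · exact le_rfl

theorem opening (h : IsPartialMatching w t k G σ) (hw : w (t + 1) = false) :
    IsPartialMatching w (t + 1) (k + 1) G (Function.update σ k (t + 1)) where
  supp u v huv := by have := h.supp huv; omega
  uniq := h.uniq
  base i hi hit := by
    rcases hit.lt_or_eq with hlt | rfl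
    · exact h.base i hi (by omega)
    · simp only [hw, Bool.false_eq_true, false_iff]
      rintro ⟨j, -, hj⟩
      have := h.supp hj
      omega
  mono i j hij hj := by
    rcases (Nat.lt_succ_iff.1 hj).lt_or_eq with hlt | rfl
    · rw [Function.update_of_ne (by omega), Function.update_of_ne (by omega)]
      exact h.mono hij hlt
    · rw [Function.update_of_ne (by omega), Function.update_self]
      have := (h.isStubOn hij).2.1
      omega
  stub v := by
    constructor
    · rintro ⟨h1, h2, h3⟩
      rcases h2.lt_or_eq with hlt | rfl
      · obtain ⟨i, hi, rfl⟩ := (h.stub v).1 ⟨h1, by omega, h3⟩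
        exact ⟨i, by omega, Function.update_of_ne (by omega) _ _⟩
      · exact ⟨k, by omega, Function.update_self _ _ _⟩
    · rintro ⟨i, hi, rfl⟩
      rcases (Nat.lt_succ_iff.1 hi).lt_or_eq with hlt | rfl
      · rw [Function.update_of_ne (by omega)]
        obtain ⟨h1, h2, h3⟩ := h.isStubOn hlt
        exact ⟨h1, by omega, h3⟩
      · rw [Function.update_self]
        exact ⟨by omega, le_rfl, fun u hu => by have := h.supp hu; omega⟩

theorem closing (h : IsPartialMatching w t (k + 1) G σ) (hw : w (t + 1) = true) {a : ℕ}
    (ha : a < k + 1) :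
    IsPartialMatching w (t + 1) k (G ⊔ SimpleGraph.edge (σ a) (t + 1)) (σ ∘ skip a) := by
  obtain ⟨ha1, ha2, ha3⟩ := h.isStubOn ha
  have hlt : σ a < t + 1 := by omega
  have htop : ∀ u, ¬ G.Adj (t + 1) u := fun u hu => by have := h.supp hu; omega
  refine ⟨?_, ?_, ?_, ?_, ?_⟩
  · intro u v huv
    rw [sup_edge_adj hlt] at huv
    rcases huv with huv | ⟨rfl, rfl⟩ | ⟨rfl, rfl⟩
    · have := h.supp huv; omega
    · omega
    · omega
  · intro v u u' hu hu'
    rw [sup_edge_adj hlt] at hu hu'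
    rcases hu with hu | ⟨rfl, rfl⟩ | ⟨rfl, rfl⟩ <;>
      rcases hu' with hu' | ⟨h', h''⟩ | ⟨h', h''⟩
    · exact h.uniq hu hu'
    · subst h'; exact absurd hu (ha3 _)
    · subst h'; exact absurd hu (htop _)
    · exact absurd hu' (ha3 _)
    · omega
    · omega
    · exact absurd hu' (htop _)
    · omega
    · omega
  · intro i hi hit
    simp only [sup_edge_adj hlt]
    rcases hit.lt_or_eq with hlt' | rfl
    · rw [h.base i hi (by omega)]
      constructor
      · rintro ⟨j, hj, hj'⟩
        exact ⟨j, hj, Or.inl hj'⟩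
      · rintro ⟨j, hj, hj' | hj' | hj'⟩
        · exact ⟨j, hj, hj'⟩
        · omega
        · omega
    · simp only [hw, true_iff]
      exact ⟨σ a, hlt, by simp⟩
  · intro i j hij hj
    refine h.mono ?_ ?_ <;> simp only [skip] <;> split_ifs <;> omega
  · intro v
    constructor
    · rintro ⟨h1, h2, h3⟩
      simp only [sup_edge_adj hlt, not_or] at h3
      have hv : v ≠ t + 1 := fun hv => (h3 (σ a)).2.2 ⟨hv, rfl⟩
      obtain ⟨i, hi, rfl⟩ := (h.stub v).1 ⟨h1, by omega, fun u => (h3 u).1⟩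
      have hia : i ≠ a := by
        rintro rfl
        exact (h3 (t + 1)).2.1 ⟨rfl, rfl⟩
      rcases hia.lt_or_gt with hia | hia
      · exact ⟨i, by omega, by simp [skip, hia]⟩
      · refine ⟨i - 1, by omega, ?_⟩
        have : skip a (i - 1) = i := by simp only [skip]; split_ifs <;> omega
        simp [this]
    · rintro ⟨i, hi, rfl⟩
      have hs : skip a i < k + 1 := by simp only [skip]; split_ifs <;> omega
      obtain ⟨h1, h2, h3⟩ := h.isStubOn hs
      refine ⟨h1, by simp only [Function.comp_apply]; omega, fun u hu => ?_⟩
      rw [sup_edge_adj hlt] at hu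
      have hne : σ (skip a i) ≠ σ a := by
        intro he
        rcases lt_or_ge i a with hia | hia
        · have := h.mono hia ha
          simp [skip, hia] at he
          omega
        · have : skip a i = i + 1 := by simp [skip, hia]
          rw [this] at he hs
          have := h.mono (show a < i + 1 by omega) hs
          omega
      simp only [Function.comp_apply] at hu
      rcases hu with hu | hu | hu
      · exact h3 _ hu
      · exact hne hu.1
      · omega

end IsPartialMatching

theorem Linked.mono {G : SimpleGraph ℕ} {u v v' : ℕ} (h : Linked G u v) (hv : v' ≤ v) :
    Linked G u v' := by
  obtain ⟨x, y, hxy, hx, hy⟩ := h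
  exact ⟨x, y, hxy, hx, by omega⟩

theorem Extendable.closing {w : ℕ → Bool} {t k : ℕ} {G : SimpleGraph ℕ} {σ : ℕ → ℕ}
    (hG : Extendable t G) (h : IsPartialMatching w t k G σ) {b : ℕ}
    (hb : b < k) (hlink : ∀ j, b < j → j < k → ¬ Linked G (σ b) (σ j)) :
    Extendable (t + 1) (G ⊔ SimpleGraph.edge (σ b) (t + 1)) := by
  obtain ⟨hb1, hb2, hb3⟩ := h.isStubOn hb
  have hlt : σ b < t + 1 := by omega
  have hsupp : ∀ {u v}, u < v → (G ⊔ SimpleGraph.edge (σ b) (t + 1)).Adj u v →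
      (G.Adj u v ∧ v ≤ t) ∨ (u = σ b ∧ v = t + 1) := by
    intro u v huv hadj
    rw [sup_edge_adj hlt] at hadj
    rcases hadj with hadj | hadj | hadj
    · exact Or.inl ⟨hadj, (h.supp hadj.symm).2⟩
    · exact Or.inr hadj
    · omega
  constructor
  · intro hc
    obtain ⟨p, q, x, r, s, u, h1, h2, h3, h4, h5, hpr, hqs, hxu⟩ := hc.exists_crossing
    have hu : u ≤ t + 1 := by rcases hsupp (by omega) hxu with h' | h' <;> omega
    rcases hsupp (by omega) hpr with ⟨hpr, -⟩ | h'
    · rcases hsupp (by omega) hqs with ⟨hqs, -⟩ | h'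
      · rcases hsupp (by omega) hxu with ⟨hxu, -⟩ | ⟨rfl, -⟩
        · exact hG.1 (containsPat_M123 (h.supp hpr).1 h1 h2 h3 h4 h5 hpr hqs hxu)
        · exact hG.2 p q _ r s h1 h2 h3 h4 hpr hqs ⟨hb1, hb2, hb3⟩
      · omega
    · omega
  · intro p q x r s h1 h2 h3 h4 hpr hqs hx
    obtain ⟨hx1, hx2, hx3⟩ := hx
    have hs : s ≤ t + 1 := by rcases hsupp (by omega) hqs with h' | h' <;> omega
    have hxG : IsStubOn t G x := ⟨hx1, by omega, fun u hu => hx3 u (Or.inl hu)⟩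
    rcases hsupp (by omega) hpr with ⟨hpr, -⟩ | h'
    · rcases hsupp (by omega) hqs with ⟨hqs, -⟩ | ⟨rfl, -⟩
      · exact hG.2 p q x r s h1 h2 h3 h4 hpr hqs hxG
      · obtain ⟨j, hj, rfl⟩ := (h.stub x).1 hxG
        exact hlink j (h.lt_of_lt hb h2) hj ⟨p, r, hpr, h1, h3⟩
    · omega

theorem Extendable.opening {w : ℕ → Bool} {t k : ℕ} {G : SimpleGraph ℕ} {σ : ℕ → ℕ}
    (hG : Extendable t G) (h : IsPartialMatching w t k G σ) : Extendable (t + 1) G := by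
  refine ⟨hG.1, fun p q x r s h1 h2 h3 h4 hpr hqs hx => ?_⟩
  have := (h.supp hpr.symm).2
  exact hG.2 p q x r s h1 h2 h3 h4 hpr hqs ⟨hx.1, by omega, hx.2.2⟩

/-- In an `M132`-avoiding extension, the next r-vertex closes a stub that is linked to no
earlier stub. -/
theorem extensions_M132_subset {n : ℕ} {w : ℕ → Bool} {t k : ℕ} {G : SimpleGraph ℕ} {σ : ℕ → ℕ}
    (h : IsPartialMatching w t k G σ) (ht : t < n) (hw : w (t + 1) = true) :
    extensions n w M132 t G ⊆ ⋃ a ∈ {a | a < k ∧ ∀ i < a, ¬ Linked G (σ i) (σ a)},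
      extensions n w M132 (t + 1) (G ⊔ SimpleGraph.edge (σ a) (t + 1)) := by
  rintro K ⟨hK, hb, hav, hag⟩
  obtain ⟨x, hx, hadj⟩ := (hb (t + 1) (by omega) (by omega)).1 hw
  have huniq : ∀ {v u u'}, K.Adj v u → K.Adj v u' → u = u' := by
    intro v u u' hu hu'
    have := hK.1 v u hu
    exact (hK.2 v this.1 this.2.1).unique hu hu'
  have hstub : IsStubOn t G x := by
    refine ⟨(hK.1 _ _ hadj).2.2.1, by omega, fun u hu => ?_⟩
    have hut := (h.supp hu.symm).2
    have := huniq ((hag x u (by omega) hut).2 hu) hadj.symm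
    omega
  obtain ⟨a, ha, rfl⟩ := (h.stub x).1 hstub
  simp only [Set.mem_iUnion, Set.mem_ofPred_eq]
  refine ⟨a, ⟨ha, ?_⟩, hK, hb, hav, ?_⟩
  · rintro i hi ⟨p, q, hpq, hp, hq⟩
    obtain ⟨hi1, hi2, hi3⟩ := h.isStubOn (hi.trans ha)
    have hia := h.mono hi ha
    have hp' := h.supp hpq
    have hq' := h.supp hpq.symm
    obtain ⟨z, hz, -⟩ := hK.2 (σ i) hi1 (by omega)
    have hzt : t < z := by
      by_contra hzt
      exact hi3 z ((hag _ _ hi2 (by omega)).1 hz)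
    have hzt' : z ≠ t + 1 := by
      rintro rfl
      have := huniq hz.symm hadj
      omega
    exact hav (containsPat_M132 hp'.1 hp hia hq (by omega) (by omega)
      ((hag p q hp'.2 hq'.2).2 hpq) hz hadj.symm)
  · intro u v hu hv
    rw [sup_edge_adj hx]
    have hG : ∀ u, ¬ G.Adj (t + 1) u := fun u hu => by have := h.supp hu; omega
    rcases hu.lt_or_eq with hu | rfl
    · rcases hv.lt_or_eq with hv | rfl
      · rw [hag u v (by omega) (by omega)]
        constructor
        · exact Or.inl
        · rintro (h' | h' | h')
          · exact h'
          · omega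
          · omega
      · constructor
        · intro h'
          exact Or.inr (Or.inl ⟨huniq h'.symm hadj, rfl⟩)
        · rintro (h' | h' | h')
          · exact absurd h'.symm (hG _)
          · rw [h'.1]; exact hadj.symm
          · omega
    · constructor
      · intro h'
        exact Or.inr (Or.inr ⟨rfl, huniq h' hadj⟩)
      · rintro (h' | h' | h')
        · exact absurd h' (hG _)
        · omega
        · rw [h'.2]; exact hadj

theorem extensions_opening_subset {n : ℕ} {w : ℕ → Bool} {t k : ℕ} {G H : SimpleGraph ℕ}
    {σ : ℕ → ℕ} (h : IsPartialMatching w t k G σ) (ht : t < n) (hw : w (t + 1) = false) :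
    extensions n w H t G ⊆ extensions n w H (t + 1) G := by
  rintro K ⟨hK, hb, hav, hag⟩
  refine ⟨hK, hb, hav, fun u v hu hv => ?_⟩
  have hG : ∀ u, ¬ G.Adj (t + 1) u := fun u hu => by have := h.supp hu; omega
  have hK' : ∀ u ≤ t + 1, ¬ K.Adj (t + 1) u := by
    intro u hu hadj
    have hne := hadj.ne
    have := (hb (t + 1) (by omega) (by omega)).2 ⟨u, by omega, hadj⟩
    simp [hw] at this
  rcases hu.lt_or_eq with hu' | rfl
  · rcases hv.lt_or_eq with hv' | rfl
    · exact hag u v (by omega) (by omega)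
    · exact iff_of_false (fun h' => hK' _ hu h'.symm) fun h' => hG _ h'.symm
  · exact iff_of_false (hK' _ hv) (hG _)

theorem extensions_succ_subset {n : ℕ} {w : ℕ → Bool} {t : ℕ} {G H : SimpleGraph ℕ} :
    extensions n w H (t + 1) G ⊆ extensions n w H t G := by
  rintro K ⟨hK, hb, hav, hag⟩
  exact ⟨hK, hb, hav, fun u v hu hv => hag u v (by omega) (by omega)⟩

theorem extensions_closing_subset {n : ℕ} {w : ℕ → Bool} {t x : ℕ} {G H : SimpleGraph ℕ}
    (hx : x < t + 1) :
    extensions n w H (t + 1) (G ⊔ SimpleGraph.edge x (t + 1)) ⊆ extensions n w H t G := by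
  rintro K ⟨hK, hb, hav, hag⟩
  refine ⟨hK, hb, hav, fun u v hu hv => ?_⟩
  rw [hag u v (by omega) (by omega), sup_edge_adj hx]
  constructor
  · rintro (h | h | h)
    · exact h
    · omega
    · omega
  · exact Or.inl

theorem disjoint_extensions_closing {n : ℕ} {w : ℕ → Bool} {t x y : ℕ} {G H : SimpleGraph ℕ}
    (hx : x < t + 1) (hy : y < t + 1) (hxy : x ≠ y) :
    Disjoint (extensions n w H (t + 1) (G ⊔ SimpleGraph.edge x (t + 1)))
      (extensions n w H (t + 1) (G ⊔ SimpleGraph.edge y (t + 1))) := by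
  rw [Set.disjoint_left]
  rintro K ⟨hK, -, -, hag⟩ ⟨-, -, -, hag'⟩
  have h1 := (hag (t + 1) x le_rfl hx.le).2 (by simp [sup_edge_adj hx])
  have h2 := (hag' (t + 1) y le_rfl hy.le).2 (by simp [sup_edge_adj hy])
  have := hK.1 _ _ h1
  exact hxy ((hK.2 (t + 1) this.1 this.2.1).unique h1 h2)

/-- If a new block starts at each index below `k` satisfying `P`, the block of `a` has a last
index `b`. -/
theorem exists_block_end (P : ℕ → Prop) {k a : ℕ} (ha : a < k) :
    ∃ b, a ≤ b ∧ b < k ∧ (∀ c, a < c → c ≤ b → ¬ P c) ∧ (b + 1 < k → P (b + 1)) := by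
  classical
  let s := (Finset.range k).filter fun b => a ≤ b ∧ ∀ c, a < c → c ≤ b → ¬ P c
  have hs : s.Nonempty := ⟨a, by simp only [s, Finset.mem_filter, Finset.mem_range]
                                 exact ⟨ha, le_rfl, fun c h1 h2 => by omega⟩⟩
  obtain ⟨b, hmem, hmax⟩ := s.exists_max_image id hs
  simp only [s, Finset.mem_filter, Finset.mem_range, id] at hmem hmax
  refine ⟨b, hmem.2.1, hmem.1, hmem.2.2, fun hb => ?_⟩
  by_contra hP
  have := hmax (b + 1) ⟨hb, by omega, fun c h1 h2 => ?_⟩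
  · omega
  · rcases h2.lt_or_eq with h2 | rfl
    · exact hmem.2.2 c h1 (by omega)
    · exact hP

theorem extensions_self_subset {n : ℕ} {w : ℕ → Bool} {k : ℕ} {G H : SimpleGraph ℕ} {σ : ℕ → ℕ}
    (h : IsPartialMatching w n k G σ) : extensions n w H n G ⊆ {G} := by
  rintro K ⟨hK, -, -, hag⟩
  ext u v
  constructor
  · intro huv
    have := hK.1 u v huv
    exact (hag u v (by omega) (by omega)).1 huv
  · intro huv
    exact (hag u v (h.supp huv).2 (h.supp huv.symm).2).2 huv

theorem ncard_extensions_le {n : ℕ} {w : ℕ → Bool} (d : ℕ) :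
    ∀ {t k : ℕ} {G G' : SimpleGraph ℕ} {σ σ' : ℕ → ℕ}, t + d = n →
      IsPartialMatching w t k G σ → IsPartialMatching w t k G' σ' → Extendable t G' →
      (∀ i j, i < j → j < k → Linked G' (σ' i) (σ' j) → Linked G (σ i) (σ j)) →
      (extensions n w M132 t G).ncard ≤ (extensions n w M123 t G').ncard := by
  induction d with
  | zero =>
    intro t k G G' σ σ' ht h h' hG' hlink
    obtain rfl : t = n := ht
    rcases (extensions t w M132 t G).eq_empty_or_nonempty with he | ⟨K, hK⟩
    · simp [he]
    · obtain rfl : K = G := extensions_self_subset h hK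
      have hk : k = 0 := by
        by_contra hk
        obtain ⟨h1, h2, h3⟩ := h.isStubOn (Nat.pos_of_ne_zero hk)
        obtain ⟨u, hu, -⟩ := hK.1.2 _ h1 h2
        exact h3 u hu
      subst hk
      have hmem : G' ∈ extensions t w M123 t G' := by
        refine ⟨⟨fun u v huv => ?_, fun v h1 h2 => ?_⟩, h'.base, hG'.1, fun _ _ _ _ => Iff.rfl⟩
        · exact ⟨(h'.supp huv).1, (h'.supp huv).2, h'.supp huv.symm⟩
        · by_contra hv
          have hs : IsStubOn t G' v := ⟨h1, h2, fun u hu =>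
            hv ⟨u, hu, fun u' hu' => h'.uniq hu' hu⟩⟩
          obtain ⟨i, hi, -⟩ := (h'.stub v).1 hs
          omega
      calc (extensions t w M132 t K).ncard ≤ ({K} : Set (SimpleGraph ℕ)).ncard :=
            Set.ncard_le_ncard (extensions_self_subset h)
        _ = ({G'} : Set (SimpleGraph ℕ)).ncard := by simp
        _ ≤ _ := Set.ncard_le_ncard (by simpa using hmem) (finite_extensions ..)
  | succ d ih =>
    intro t k G G' σ σ' ht h h' hG' hlink
    cases hw : w (t + 1) with
    | false =>
      calc (extensions n w M132 t G).ncard ≤ (extensions n w M132 (t + 1) G).ncard :=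
            Set.ncard_le_ncard (extensions_opening_subset h (by omega) hw) (finite_extensions ..)
        _ ≤ (extensions n w M123 (t + 1) G').ncard := by
            refine ih (by omega) (h.opening hw) (h'.opening hw) (hG'.opening h') ?_
            intro i j hij hj hl
            rcases (Nat.lt_succ_iff.1 hj).lt_or_eq with hlt | rfl
            · rw [Function.update_of_ne (by omega), Function.update_of_ne (by omega)] at hl ⊢
              exact hlink i j hij hlt hl
            · rw [Function.update_self] at hl
              obtain ⟨x, y, hxy, -, hy⟩ := hl
              have := h'.supp hxy.symm
              omega
        _ ≤ _ := Set.ncard_le_ncard extensions_succ_subset (finite_extensions ..)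
    | true =>
      classical
      rcases k with _ | k
      · have hsub := extensions_M132_subset h (show t < n by omega) hw
        have : extensions n w M132 t G = ∅ := by
          refine Set.eq_empty_of_forall_notMem fun K hK => ?_
          simpa using hsub hK
        simp [this]
      set P : ℕ → Prop := fun a => ∀ i < a, ¬ Linked G (σ i) (σ a)
      have hend := fun a : ℕ => fun ha : a < k + 1 => exists_block_end P ha
      choose! e hae hek hmid hnext using hend
      set s := (Finset.range (k + 1)).filter P with hs
      have hsP : ∀ a ∈ s, a < k + 1 ∧ P a := fun a ha => by simpa [hs] using ha
      have hinj : ∀ a ∈ s, ∀ b ∈ s, a ≠ b → e a ≠ e b := by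
        have key : ∀ a ∈ s, ∀ b ∈ s, a < b → e a ≠ e b := by
          intro a ha b hb hab heq
          have hbe := hae b (hsP b hb).1
          exact hmid a (hsP a ha).1 b hab (by omega) (hsP b hb).2
        intro a ha b hb hab
        rcases hab.lt_or_gt with hab | hab
        · exact key a ha b hb hab
        · exact (key b hb a ha hab).symm
      have hlt' : ∀ a ∈ s, σ' (e a) < t + 1 := fun a ha => by
        have := (h'.isStubOn (hek a (hsP a ha).1)).2.1
        omega
      have hstep : ∀ a ∈ s,
          (extensions n w M132 (t + 1) (G ⊔ SimpleGraph.edge (σ a) (t + 1))).ncard ≤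
          (extensions n w M123 (t + 1) (G' ⊔ SimpleGraph.edge (σ' (e a)) (t + 1))).ncard := by
        intro a ha
        obtain ⟨hak, hPa⟩ := hsP a ha
        have hae := hae a hak
        have hek := hek a hak
        refine ih (by omega) (h.closing hw hak) (h'.closing hw hek) (hG'.closing h' hek ?_) ?_
        · intro j hj hjk hl
          exact hnext a hak (by omega) (e a) (by omega)
            ((hlink _ _ hj hjk hl).mono (h.le_of_le (by omega) hjk))
        · intro i j hij hj hl
          have hσ : σ a < t + 1 := by
            have := (h.isStubOn hak).2.1
            omega
          have hskip : ∀ c l, l < k → skip c l < k + 1 ∧ l ≤ skip c l := by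
            intro c l hl
            simp only [skip]
            split_ifs <;> omega
          simp only [Function.comp_apply] at hl ⊢
          rcases lt_or_ge i a with hia | hia
          · have e1 : skip a i = i := by simp [skip, hia]
            have e2 : skip (e a) i = i := by simp [skip, show i < e a by omega]
            rw [e1]
            rw [e2] at hl
            have hl' : Linked G (σ i) (σ (skip (e a) j)) := by
              refine hlink _ _ (by have := (hskip (e a) j hj).2; omega) (hskip _ _ hj).1 ?_
              obtain ⟨x, y, hxy, hx, hy⟩ := hl
              rw [sup_edge_adj (hlt' a ha)] at hxy
              have hm := h'.mono (show i < e a by omega) hek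
              have hi := (h'.isStubOn (show i < k + 1 by omega)).2.1
              rcases hxy with hxy | hxy | hxy
              · exact ⟨x, y, hxy, hx, hy⟩
              · omega
              · omega
            rcases lt_or_ge j a with hja | hja
            · rw [show skip a j = j by simp [skip, hja]]
              rw [show skip (e a) j = j by simp [skip, show j < e a by omega]] at hl'
              obtain ⟨x, y, hxy, hx, hy⟩ := hl'
              exact ⟨x, y, Or.inl hxy, hx, hy⟩
            · refine absurd (hl'.mono (h.le_of_le ?_ (hskip _ _ hj).1)) (hPa i hia)
              have := (hskip (e a) j hj).2
              omega
          · refine ⟨σ a, t + 1, ?_, ?_, ?_⟩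
            · simp [sup_edge_adj hσ]
            · refine h.mono ?_ (hskip a i (by omega)).1
              simp only [skip]
              split_ifs <;> omega
            · have := (h.isStubOn (hskip a j hj).1).2.1
              omega
      calc (extensions n w M132 t G).ncard
          ≤ (⋃ a ∈ s, extensions n w M132 (t + 1) (G ⊔ SimpleGraph.edge (σ a) (t + 1))).ncard := by
            refine Set.ncard_le_ncard ?_ (s.finite_toSet.biUnion fun _ _ => finite_extensions ..)
            refine (extensions_M132_subset h (by omega) hw).trans ?_
            refine Set.biUnion_subset_biUnion_left fun a ha => ?_
            simpa [hs] using ha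
        _ ≤ ∑ a ∈ s, (extensions n w M132 (t + 1)
              (G ⊔ SimpleGraph.edge (σ a) (t + 1))).ncard := Finset.set_ncard_biUnion_le s _
        _ ≤ ∑ a ∈ s, (extensions n w M123 (t + 1)
              (G' ⊔ SimpleGraph.edge (σ' (e a)) (t + 1))).ncard := Finset.sum_le_sum hstep
        _ = (⋃ a ∈ s, extensions n w M123 (t + 1)
              (G' ⊔ SimpleGraph.edge (σ' (e a)) (t + 1))).ncard := by
            rw [← finsum_mem_coe_finset]
            refine (s.finite_toSet.ncard_biUnion (fun _ _ => finite_extensions ..) ?_).symm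
            intro a ha b hb hab
            refine disjoint_extensions_closing (hlt' a ha) (hlt' b hb) fun heq => ?_
            have hea := hek a (hsP a ha).1
            have heb := hek b (hsP b hb).1
            rcases (hinj a ha b hb hab).lt_or_gt with hlt | hlt
            · exact (h'.mono hlt heb).ne heq
            · exact (h'.mono hlt hea).ne' heq
        _ ≤ (extensions n w M123 t G').ncard :=
            Set.ncard_le_ncard (Set.iUnion₂_subset fun a ha =>
              extensions_closing_subset (hlt' a ha)) (finite_extensions ..)

/-- `g(m,w,M_132) ≤ g(m,w,M_123)` for every positive `m` and
Dyck word `w` of length `2m`. -/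
theorem stmt3 (m : ℕ) (hm : 0 < m) (w : ℕ → Bool) (hw : IsDyckWord (2*m) w) :
    Nat.card {G : SimpleGraph ℕ // IsMatchingOn (2*m) G ∧ HasBase (2*m) G w ∧
      ¬ ContainsPat G M132} ≤
    Nat.card {G : SimpleGraph ℕ // IsMatchingOn (2*m) G ∧ HasBase (2*m) G w ∧
      ¬ ContainsPat G M123} := by
  have h : IsPartialMatching w 0 0 ⊥ id :=
    { supp := fun u v huv => huv.elim
      uniq := fun v u u' hu => hu.elim
      base := fun i h1 h2 => by omega
      mono := fun i j _ hj => by omega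
      stub := fun v => ⟨fun hv => by have := hv.1; have := hv.2.1; omega,
        fun ⟨i, hi, _⟩ => by omega⟩ }
  have hext : Extendable 0 ⊥ := by
    refine ⟨fun hc => ?_, fun p q x r s _ _ _ _ hpr => hpr.elim⟩
    obtain ⟨p, q, x, r, s, u, -, -, -, -, -, hpr, -⟩ := hc.exists_crossing
    exact hpr
  have hcard : ∀ H : SimpleGraph ℕ, Nat.card {G : SimpleGraph ℕ // IsMatchingOn (2*m) G ∧
      HasBase (2*m) G w ∧ ¬ ContainsPat G H} = (extensions (2*m) w H 0 ⊥).ncard := by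
    intro H
    rw [← Nat.card_coe_set_eq]
    refine Nat.card_congr (Equiv.subtypeEquivRight fun G => ?_)
    simp only [extensions, Set.mem_ofPred_eq]
    refine ⟨fun ⟨h1, h2, h3⟩ => ⟨h1, h2, h3, fun u v hu hv => ?_⟩,
      fun ⟨h1, h2, h3, _⟩ => ⟨h1, h2, h3⟩⟩
    refine iff_of_false (fun huv => ?_) (fun huv => huv)
    have := h1.1 u v huv
    omega
  rw [hcard, hcard]
  exact ncard_extensions_le (2*m) (by omega) h h hext fun i j _ hj => by omega
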